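/- arXiv:2011.08166 — 3 statements merged into one kernel-verified Lean document; each statement's English description precedes it below -/
import Mathlib

section
/- Let x̄ ∈ 𝒳*, let q ∈ (0,1], and suppose there exist ε₁ > 0 and κ₁ > 0 such that dist(x; 𝒳*) ≤ κ₁ · dist(0; ∇f(x) + ∂g(x))^q for all x with ‖x − x̄‖ < ε₁ (metric q-subregularity of ∇f + ∂g at (x̄,0)). Then, setting ε₂ = min{1/(2+L₁), ε₁} and κ₂ = 1 + κ₁(1+L₁)^q, one has dist(x; 𝒳*) ≤ κ₂ ‖𝒢(x)‖^q for all x with ‖x − x̄‖ < ε₂. -/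
open scoped RealInnerProductSpace
open Metric Set Filter

noncomputable section

abbrev En (n : ℕ) : Type := EuclideanSpace ℝ (Fin n)

/-- Convex subdifferential of an extended-real-valued function `g` at `x`. -/
def ESubdiff {n : ℕ} (g : En n → EReal) (x : En n) : Set (En n) :=
  {v | ∀ y, g x + ((⟪v, y - x⟫ : ℝ) : EReal) ≤ g y}

/-- `g` is proper: it never takes the value `-∞` and is finite somewhere. -/
def ProperFun {n : ℕ} (g : En n → EReal) : Prop :=
  (∀ x, g x ≠ ⊥) ∧ ∃ x, g x ≠ ⊤

/-- Convexity for extended-real-valued functions. -/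
def EConvexOn {n : ℕ} (g : En n → EReal) : Prop :=
  ∀ x y : En n, ∀ a b : ℝ, 0 ≤ a → 0 ≤ b → a + b = 1 →
    g (a • x + b • y) ≤ (a : EReal) * g x + (b : EReal) * g y

/-- `p` minimizes `y ↦ g y + ‖y - u‖ ^ 2 / 2`. -/
def IsProxPt {n : ℕ} (g : En n → EReal) (u p : En n) : Prop :=
  ∀ y, g p + ((‖p - u‖ ^ 2 / 2 : ℝ) : EReal) ≤ g y + ((‖y - u‖ ^ 2 / 2 : ℝ) : EReal)

/-- `prox` maps each `u` to the unique minimizer of `y ↦ g y + ‖y - u‖ ^ 2 / 2`. -/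
def IsProxMap {n : ℕ} (g : En n → EReal) (prox : En n → En n) : Prop :=
  ∀ u, IsProxPt g u (prox u) ∧ ∀ p, IsProxPt g u p → p = prox u

/-- The solution set `𝒳* = argmin (f + g)`. -/
def ArgminSet {n : ℕ} (f : En n → ℝ) (g : En n → EReal) : Set (En n) :=
  {x | ∀ y, (f x : EReal) + g x ≤ (f y : EReal) + g y}

/-- The prox-gradient mapping `𝒢 x = x - Prox_g (x - ∇f x)`. -/
def Gmap {n : ℕ} (f' prox : En n → En n) (x : En n) : En n :=
  x - prox (x - f' x)

lemma le_of_hasDerivAt_of_mul_le_sub {φ : ℝ → ℝ} {φ' m : ℝ} (h : HasDerivAt φ φ' 0)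
    (hm : ∀ t ∈ Ioo (0 : ℝ) 1, m * t ≤ φ t - φ 0) : m ≤ φ' := by
  have hs := (hasDerivAt_iff_tendsto_slope.1 h).mono_left
    (nhdsWithin_mono 0 (show Ioi (0 : ℝ) ⊆ {0}ᶜ from fun t ht => (mem_Ioi.1 ht).ne'))
  refine ge_of_tendsto hs ?_
  filter_upwards [Ioo_mem_nhdsGT (zero_lt_one (α := ℝ))] with t ht
  rw [slope_def_field, sub_zero, le_div_iff₀ ht.1]
  exact hm t ht

lemma HasGradientAt.hasDerivAt_comp_line {E : Type*} [NormedAddCommGroup E]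
    [InnerProductSpace ℝ E] [CompleteSpace E] {f : E → ℝ} {v x d : E} {t : ℝ}
    (h : HasGradientAt f v (x + t • d)) :
    HasDerivAt (fun s : ℝ => f (x + s • d)) ⟪v, d⟫ t := by
  have hl : HasDerivAt (fun s : ℝ => x + s • d) d t := by
    simpa using ((hasDerivAt_id t).smul_const d).const_add x
  simpa [Function.comp_def] using h.hasFDerivAt.comp_hasDerivAt t hl

section Smooth

variable {E : Type*} [NormedAddCommGroup E] [InnerProductSpace ℝ E] [CompleteSpace E]
  {f : E → ℝ} {f' : E → E} {L : ℝ}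

lemma ConvexOn.add_inner_gradient_le (hf : ConvexOn ℝ univ f) {v x : E}
    (h : HasGradientAt f v x) (y : E) : f x + ⟪v, y - x⟫ ≤ f y := by
  have hd : HasDerivAt (fun s : ℝ => f (x + s • (y - x))) ⟪v, y - x⟫ 0 :=
    HasGradientAt.hasDerivAt_comp_line (by simpa using h)
  have := le_of_hasDerivAt_of_mul_le_sub (m := f x - f y) hd.neg (fun t ht => by
    have hc := hf.2 (mem_univ x) (mem_univ y) (sub_nonneg.2 ht.2.le) ht.1.le
      (sub_add_cancel 1 t)
    have he : (1 - t) • x + t • y = x + t • (y - x) := by module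
    rw [he] at hc
    simp only [smul_eq_mul] at hc
    simp only [Pi.neg_apply, zero_smul, add_zero]
    linarith)
  linarith

lemma le_add_inner_gradient_add_sq (hgrad : ∀ x, HasGradientAt f (f' x) x)
    (hlip : ∀ x y, ‖f' x - f' y‖ ≤ L * ‖x - y‖) (x y : E) :
    f y ≤ f x + ⟪f' x, y - x⟫ + L / 2 * ‖y - x‖ ^ 2 := by
  set d := y - x with hd
  have hder : ∀ t : ℝ, HasDerivAt
      (fun s : ℝ => f (x + s • d) - s * ⟪f' x, d⟫ - s ^ 2 * (L / 2 * ‖d‖ ^ 2))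
      (⟪f' (x + t • d), d⟫ - ⟪f' x, d⟫ - 2 * t * (L / 2 * ‖d‖ ^ 2)) t := fun t => by
    have h1 := HasGradientAt.hasDerivAt_comp_line (hgrad (x + t • d))
    have h2 := (hasDerivAt_id t).mul_const ⟪f' x, d⟫
    have h3 := ((hasDerivAt_id t).pow 2).mul_const (L / 2 * ‖d‖ ^ 2)
    refine ((h1.sub h2).sub h3).congr_deriv ?_
    simp
  have hanti : AntitoneOn
      (fun s : ℝ => f (x + s • d) - s * ⟪f' x, d⟫ - s ^ 2 * (L / 2 * ‖d‖ ^ 2)) (Icc 0 1) := by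
    refine antitoneOn_of_deriv_nonpos (convex_Icc 0 1)
      (fun t _ => (hder t).continuousAt.continuousWithinAt)
      (fun t _ => (hder t).differentiableAt.differentiableWithinAt) (fun t ht => ?_)
    rw [interior_Icc] at ht
    rw [(hder t).deriv, ← inner_sub_left]
    have h1 := real_inner_le_norm (f' (x + t • d) - f' x) d
    have h2 := hlip (x + t • d) x
    rw [add_sub_cancel_left, norm_smul, Real.norm_of_nonneg ht.1.le] at h2
    nlinarith [norm_nonneg d]
  have h01 := hanti (left_mem_Icc.2 zero_le_one) (right_mem_Icc.2 zero_le_one) zero_le_one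
  have hy : x + d = y := by simp [hd]
  simp only [zero_smul, one_smul, add_zero, hy] at h01
  linarith

/-- One half of the Baillon–Haddad inequality. -/
lemma ConvexOn.add_inner_gradient_add_sq_le (hf : ConvexOn ℝ univ f)
    (hgrad : ∀ x, HasGradientAt f (f' x) x) (hL : 0 < L)
    (hlip : ∀ x y, ‖f' x - f' y‖ ≤ L * ‖x - y‖) (x y : E) :
    f x + ⟪f' x, y - x⟫ + ‖f' y - f' x‖ ^ 2 / (2 * L) ≤ f y := by
  set k := f' y - f' x with hk
  have h1 := hf.add_inner_gradient_le (hgrad x) (y - L⁻¹ • k)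
  have h2 := le_add_inner_gradient_add_sq hgrad hlip y (y - L⁻¹ • k)
  have e1 : y - L⁻¹ • k - x = (y - x) - L⁻¹ • k := by abel
  have e2 : y - L⁻¹ • k - y = -(L⁻¹ • k) := by abel
  rw [e1, inner_sub_right, real_inner_smul_right] at h1
  rw [e2, inner_neg_right, real_inner_smul_right, norm_neg, norm_smul,
    Real.norm_of_nonneg (inv_pos.2 hL).le] at h2
  have h3 : ⟪f' y, k⟫ - ⟪f' x, k⟫ = ‖k‖ ^ 2 := by
    rw [← inner_sub_left, ← hk, real_inner_self_eq_norm_sq]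
  have h4 : L / 2 * (L⁻¹ * ‖k‖) ^ 2 = ‖k‖ ^ 2 / (2 * L) := by field_simp
  have h5 : L⁻¹ * ⟪f' y, k⟫ - L⁻¹ * ⟪f' x, k⟫ = 2 * (‖k‖ ^ 2 / (2 * L)) := by
    rw [← mul_sub, h3]; field_simp
  linarith

lemma ConvexOn.gradient_cocoercive (hf : ConvexOn ℝ univ f)
    (hgrad : ∀ x, HasGradientAt f (f' x) x) (hL : 0 < L)
    (hlip : ∀ x y, ‖f' x - f' y‖ ≤ L * ‖x - y‖) (x y : E) :
    ‖f' x - f' y‖ ^ 2 ≤ L * ⟪f' x - f' y, x - y⟫ := by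
  have h1 := hf.add_inner_gradient_add_sq_le hgrad hL hlip x y
  have h2 := hf.add_inner_gradient_add_sq_le hgrad hL hlip y x
  rw [norm_sub_rev, ← neg_sub x y, inner_neg_right] at h1
  have h3 : ‖f' x - f' y‖ ^ 2 / L ≤ ⟪f' x - f' y, x - y⟫ := by
    rw [inner_sub_left]
    have : ‖f' x - f' y‖ ^ 2 / L = 2 * (‖f' x - f' y‖ ^ 2 / (2 * L)) := by field_simp
    linarith
  rwa [div_le_iff₀' hL] at h3

end Smooth

section Subdifferential

variable {n : ℕ} {g : En n → EReal}

lemma ProperFun.ne_top_of_mem_ESubdiff (hg : ProperFun g) {x v : En n}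
    (hv : v ∈ ESubdiff g x) : g x ≠ ⊤ := by
  intro hx
  obtain ⟨y, hy⟩ := hg.2
  have := hv y
  rw [hx, EReal.top_add_coe] at this
  exact hy (top_le_iff.1 this)

lemma ESubdiff_monotone (hg : ProperFun g) {x y v w : En n}
    (hv : v ∈ ESubdiff g x) (hw : w ∈ ESubdiff g y) : 0 ≤ ⟪v - w, x - y⟫ := by
  have h1 := hv y
  have h2 := hw x
  lift g x to ℝ using ⟨hg.ne_top_of_mem_ESubdiff hv, hg.1 x⟩ with a
  lift g y to ℝ using ⟨hg.ne_top_of_mem_ESubdiff hw, hg.1 y⟩ with b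
  norm_cast at h1 h2
  rw [← neg_sub x y, inner_neg_right] at h1
  rw [inner_sub_left]
  linarith

lemma ProperFun.ne_top_of_forall_add_le (hg : ProperFun g) {h : En n → ℝ} {p : En n}
    (hmin : ∀ y, g p + (h p : EReal) ≤ g y + (h y : EReal)) : g p ≠ ⊤ := by
  intro hp
  obtain ⟨y, hy⟩ := hg.2
  have := hmin y
  rw [hp, EReal.top_add_coe, top_le_iff] at this
  exact EReal.add_ne_top hy (EReal.coe_ne_top _) this

/-- Fermat's rule for the sum of a convex function and a differentiable one. -/
lemma neg_mem_ESubdiff_of_forall_add_le (hg : ProperFun g) (hconv : EConvexOn g)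
    {h : En n → ℝ} {p v : En n} (hv : HasGradientAt h v p)
    (hmin : ∀ y, g p + (h p : EReal) ≤ g y + (h y : EReal)) : -v ∈ ESubdiff g p := by
  intro y
  have hp := hg.ne_top_of_forall_add_le hmin
  by_cases hy : g y = ⊤
  · rw [hy]; exact le_top
  have hd : HasDerivAt (fun s : ℝ => h (p + s • (y - p))) ⟪v, y - p⟫ 0 :=
    HasGradientAt.hasDerivAt_comp_line (by simpa using hv)
  have hc : ∀ t ∈ Ioo (0 : ℝ) 1, g p + (h p : EReal) ≤
      ((1 - t : ℝ) : EReal) * g p + (t : EReal) * g y + (h (p + t • (y - p)) : EReal) := by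
    intro t ht
    have he : (1 - t) • p + t • y = p + t • (y - p) := by module
    refine (hmin (p + t • (y - p))).trans ?_
    have := hconv p y (1 - t) t (sub_nonneg.2 ht.2.le) ht.1.le (sub_add_cancel 1 t)
    rw [he] at this
    gcongr
  lift g p to ℝ using ⟨hp, hg.1 p⟩ with a
  lift g y to ℝ using ⟨hy, hg.1 y⟩ with b
  have := le_of_hasDerivAt_of_mul_le_sub (m := a - b) hd (fun t ht => by
    have := hc t ht
    norm_cast at this
    simp only [zero_smul, add_zero]
    linarith)
  norm_cast
  rw [inner_neg_left]
  linarith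

lemma hasGradientAt_half_mul_norm_sub_sq {E : Type*} [NormedAddCommGroup E]
    [InnerProductSpace ℝ E] [CompleteSpace E] (c : ℝ) (u p : E) :
    HasGradientAt (fun y => c * (‖y - u‖ ^ 2 / 2)) (c • (p - u)) p := by
  rw [hasGradientAt_iff_hasFDerivAt]
  have h := (((hasFDerivAt_id p).sub_const u).norm_sq.mul_const (2⁻¹ : ℝ)).const_mul c
  refine (h.congr_fderiv ?_).congr_of_eventuallyEq (Eventually.of_forall fun y => by simp only [id_eq]; ring)
  ext z
  simp

lemma IsProxPt.mem_ESubdiff (hg : ProperFun g) (hconv : EConvexOn g) {u p : En n}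
    (h : IsProxPt g u p) : u - p ∈ ESubdiff g p := by
  have := neg_mem_ESubdiff_of_forall_add_le hg hconv
    (hasGradientAt_half_mul_norm_sub_sq 1 u p) (by simpa only [one_mul] using! h)
  simpa using this

lemma exists_forall_add_mul_norm_sub_sq_le (hg : ProperFun g) (hlsc : LowerSemicontinuous g)
    {u p : En n} (h : IsProxPt g u p) {c : ℝ} (hc : 1 < c) :
    ∃ z, ∀ y, g z + ((c * (‖z - u‖ ^ 2 / 2) : ℝ) : EReal) ≤
      g y + ((c * (‖y - u‖ ^ 2 / 2) : ℝ) : EReal) := by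
  have hcont : Continuous (fun y : En n => ((c * (‖y - u‖ ^ 2 / 2) : ℝ) : EReal)) :=
    continuous_coe_real_ereal.comp (by fun_prop)
  have hψ : LowerSemicontinuous
      (fun y : En n => g y + ((c * (‖y - u‖ ^ 2 / 2) : ℝ) : EReal)) :=
    hlsc.add' hcont.lowerSemicontinuous fun x =>
      EReal.continuousAt_add (Or.inr (EReal.coe_ne_bot _)) (Or.inr (EReal.coe_ne_top _))
  obtain ⟨z, -, hz⟩ := (hψ.lowerSemicontinuousOn _).exists_isMinOn
    ⟨p, show p ∈ closedBall u ‖p - u‖ by simp [dist_eq_norm]⟩ (isCompact_closedBall u ‖p - u‖)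
  refine ⟨z, fun y => ?_⟩
  by_cases hy : y ∈ closedBall u ‖p - u‖
  · exact hz hy
  refine (hz (show p ∈ closedBall u ‖p - u‖ by simp [dist_eq_norm])).trans ?_
  rw [mem_closedBall, dist_eq_norm, not_le] at hy
  have hpy := h y
  have hp : g p ≠ ⊤ := hg.ne_top_of_forall_add_le (h := fun y => ‖y - u‖ ^ 2 / 2) h
  by_cases hyt : g y = ⊤
  · simp only [hyt, EReal.top_add_coe, le_top]
  simp only
  lift g p to ℝ using ⟨hp, hg.1 p⟩ with a
  lift g y to ℝ using ⟨hyt, hg.1 y⟩ with b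
  norm_cast at hpy ⊢
  have : ‖p - u‖ ^ 2 ≤ ‖y - u‖ ^ 2 := by gcongr
  nlinarith

/-- Forward-backward steps `a` and `b` of step sizes `1 / c` and `1` from the same point. -/
lemma norm_le_norm_of_mem_ESubdiff (hg : ProperFun g) {c : ℝ} (hc : 1 < c) {x w a b : En n}
    (ha : c • a - w ∈ ESubdiff g (x - a)) (hb : b - w ∈ ESubdiff g (x - b)) : ‖a‖ ≤ ‖b‖ := by
  have h := ESubdiff_monotone hg ha hb
  have e1 : c • a - w - (b - w) = c • a - b := by abel
  have e2 : x - a - (x - b) = b - a := by abel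
  rw [e1, e2, inner_sub_left, inner_sub_right, inner_sub_right, real_inner_smul_left,
    real_inner_smul_left, real_inner_self_eq_norm_sq, real_inner_self_eq_norm_sq,
    real_inner_comm b a] at h
  have hab := real_inner_le_norm a b
  rw [real_inner_comm] at hab
  by_contra! hlt
  have h1 : 0 < (‖a‖ - ‖b‖) * (c * ‖a‖ - ‖b‖) :=
    mul_pos (by linarith) (by nlinarith [norm_nonneg b])
  nlinarith

/-- Forward-backward steps of size `1 / c` with `L ≤ 2 * c` do not move away from solutions. -/
lemma norm_sub_le_of_mem_ESubdiff (hg : ProperFun g) {c L : ℝ} (hL : 0 < L) (hc : L ≤ 2 * c)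
    {x z w w' a : En n} (ha : c • a - w ∈ ESubdiff g (x - a)) (hz : -w' ∈ ESubdiff g z)
    (hco : ‖w - w'‖ ^ 2 ≤ L * ⟪w - w', x - z⟫) : ‖x - a - z‖ ≤ ‖x - z‖ := by
  have h := ESubdiff_monotone hg ha hz
  have e1 : c • a - w - -w' = c • a - (w - w') := by abel
  have e2 : x - a - z = x - z - a := by abel
  rw [e1, e2] at h
  rw [e2]
  generalize w - w' = k at h hco
  generalize x - z = d at h hco ⊢
  rw [inner_sub_left, inner_sub_right, inner_sub_right, real_inner_smul_left,
    real_inner_smul_left, real_inner_self_eq_norm_sq] at h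
  refine (sq_le_sq₀ (norm_nonneg _) (norm_nonneg _)).1 ?_
  have hsq : 0 ≤ ‖k - (L / 2) • a‖ ^ 2 := sq_nonneg _
  rw [norm_sub_sq_real, real_inner_smul_right, norm_smul, Real.norm_of_nonneg (by positivity)]
    at hsq
  rw [norm_sub_sq_real, real_inner_comm]
  have hcL : 0 ≤ (2 * c - L) * (L * ‖a‖ ^ 2) :=
    mul_nonneg (sub_nonneg.2 hc) (by positivity)
  have hLh := mul_nonneg hL.le h
  have hcpos : 0 < c * L := mul_pos (by linarith) hL
  have : 0 ≤ c * L * (2 * ⟪a, d⟫ - ‖a‖ ^ 2) := by nlinarith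
  linarith [nonneg_of_mul_nonneg_right this hcpos]

lemma norm_smul_sub_le {E : Type*} [NormedAddCommGroup E] [InnerProductSpace ℝ E] {c L : ℝ}
    (hc0 : 0 ≤ c) (hL : 0 < L) (hc : L ≤ 2 * c) {a k : E} (hk : ‖k‖ ^ 2 ≤ L * ⟪k, a⟫) :
    ‖c • a - k‖ ≤ c * ‖a‖ := by
  refine (sq_le_sq₀ (norm_nonneg _) (by positivity)).1 ?_
  rw [norm_sub_sq_real, real_inner_smul_left, real_inner_comm, norm_smul, Real.norm_of_nonneg hc0]
  have hka : 0 ≤ ⟪k, a⟫ := nonneg_of_mul_nonneg_right ((sq_nonneg _).trans hk) hL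
  nlinarith [mul_nonneg (sub_nonneg.2 hc) hka]

end Subdifferential

/-- If `∇f + ∂g` is metrically `q`-subregular at `(x̄, 0)` with `q ∈ (0,1]`
and constants `ε₁, κ₁ > 0`, then with `ε₂ = min (1/(2+L₁)) ε₁` and `κ₂ = 1 + κ₁ (1+L₁)^q`
one has `dist(x, 𝒳*) ≤ κ₂ ‖𝒢(x)‖^q` for all `x` with `‖x - x̄‖ < ε₂`. -/
theorem dist_le_of_metric_q_subregular {n : ℕ}
    (f : En n → ℝ) (f' : En n → En n) (g : En n → EReal) (prox : En n → En n)
    (L₁ : ℝ) (hL₁ : 0 < L₁)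
    (hfconv : ConvexOn ℝ Set.univ f)
    (hgrad : ∀ x, HasGradientAt f (f' x) x)
    (hgradcont : Continuous f')
    (hlip : ∀ x y : En n, ‖f' x - f' y‖ ≤ L₁ * ‖x - y‖)
    (hgproper : ProperFun g) (hglsc : LowerSemicontinuous g) (hgconv : EConvexOn g)
    (hprox : IsProxMap g prox)
    (hXne : (ArgminSet f g).Nonempty)
    (xbar : En n) (hxbar : xbar ∈ ArgminSet f g)
    (q : ℝ) (hq0 : 0 < q) (hq1 : q ≤ 1)
    (ε₁ κ₁ : ℝ) (hε₁ : 0 < ε₁) (hκ₁ : 0 < κ₁)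
    (hsubreg : ∀ x : En n, ‖x - xbar‖ < ε₁ → ∀ v ∈ ESubdiff g x,
      Metric.infDist x (ArgminSet f g) ≤ κ₁ * ‖f' x + v‖ ^ q) :
    ∀ x : En n, ‖x - xbar‖ < min (1 / (2 + L₁)) ε₁ →
      Metric.infDist x (ArgminSet f g) ≤
        (1 + κ₁ * (1 + L₁) ^ q) * ‖Gmap f' prox x‖ ^ q := by
  intro x hx
  have hx₁ : ‖x - xbar‖ < 1 / (2 + L₁) := hx.trans_le (min_le_left _ _)
  have hx₂ : ‖x - xbar‖ < ε₁ := hx.trans_le (min_le_right _ _)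
  have hxp : x - Gmap f' prox x = prox (x - f' x) := sub_sub_cancel x _
  generalize Gmap f' prox x = G at hxp ⊢
  obtain ⟨c, hc⟩ : ∃ c, 1 + L₁ = c := ⟨_, rfl⟩
  rw [hc]
  have hc1 : 1 < c := by linarith
  have hGsub : G - f' x ∈ ESubdiff g (x - G) := by
    have := (hprox (x - f' x)).1.mem_ESubdiff hgproper hgconv
    rw [← hxp] at this
    convert this using 1
    abel
  obtain ⟨z, hz⟩ := exists_forall_add_mul_norm_sub_sq_le hgproper hglsc
    (hprox (x - c⁻¹ • f' x)).1 hc1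
  obtain ⟨a, hxa⟩ : ∃ a, x - a = z := ⟨x - z, sub_sub_cancel x z⟩
  subst hxa
  have hasub : c • a - f' x ∈ ESubdiff g (x - a) := by
    have := neg_mem_ESubdiff_of_forall_add_le hgproper hgconv
      (hasGradientAt_half_mul_norm_sub_sq c (x - c⁻¹ • f' x) (x - a)) hz
    convert this using 1
    rw [smul_sub, smul_sub, smul_sub, smul_inv_smul₀ (by linarith)]
    abel
  have hbarsub : -f' xbar ∈ ESubdiff g xbar :=
    neg_mem_ESubdiff_of_forall_add_le hgproper hgconv (hgrad xbar) fun y => by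
      rw [add_comm, add_comm (g y)]
      exact hxbar y
  have hco := hfconv.gradient_cocoercive hgrad hL₁ hlip x
  have haG : ‖a‖ ≤ ‖G‖ := norm_le_norm_of_mem_ESubdiff hgproper hc1 hasub hGsub
  have hball : ‖x - a - xbar‖ ≤ ‖x - xbar‖ :=
    norm_sub_le_of_mem_ESubdiff hgproper hL₁ (by linarith) hasub hbarsub (hco xbar)
  have hres : ‖f' (x - a) + (c • a - f' x)‖ ≤ c * ‖G‖ := by
    have hk := hco (x - a)
    rw [sub_sub_cancel] at hk
    have e : f' (x - a) + (c • a - f' x) = c • a - (f' x - f' (x - a)) := by abel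
    rw [e]
    exact (norm_smul_sub_le (by linarith) hL₁ (by linarith) hk).trans (mul_le_mul_of_nonneg_left haG (by linarith))
  have hκ : 0 ≤ κ₁ * c ^ q := by positivity
  rcases le_or_gt ‖G‖ 1 with hG1 | hG1
  · have hGq : ‖G‖ ≤ ‖G‖ ^ q := by
      simpa using Real.rpow_le_rpow_of_exponent_ge' (norm_nonneg G) hG1 hq0.le hq1
    calc infDist x (ArgminSet f g)
        ≤ infDist (x - a) (ArgminSet f g) + dist x (x - a) := infDist_le_infDist_add_dist
      _ ≤ κ₁ * ‖f' (x - a) + (c • a - f' x)‖ ^ q + ‖a‖ := by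
        rw [dist_eq_norm, sub_sub_cancel]
        gcongr
        exact hsubreg _ (hball.trans_lt hx₂) _ hasub
      _ ≤ κ₁ * (c * ‖G‖) ^ q + ‖G‖ ^ q := by gcongr; exact haG.trans hGq
      _ = (1 + κ₁ * c ^ q) * ‖G‖ ^ q := by
        rw [Real.mul_rpow (by linarith) (norm_nonneg G)]; ring
  · have hGq : 1 ≤ ‖G‖ ^ q := Real.one_le_rpow hG1.le hq0.le
    have hd : infDist x (ArgminSet f g) ≤ 1 := by
      refine (infDist_le_dist_of_mem hxbar).trans ?_
      rw [dist_eq_norm]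
      exact hx₁.le.trans ((div_le_one (by linarith)).2 (by linarith))
    nlinarith
end
end

section
/- Let n ≥ 2, let c ∈ ℝⁿ with ‖c‖ = 1, define F(x) = ⟨c, x⟩ + ‖x‖ and 𝒳* = { −γc : γ ≥ 0 } (the set of minimizers of F). Then there exists a sequence (x_k) in ℝⁿ \ 𝒳* such that F(x_k) → 0, dist(0; c + ∂‖·‖(x_k)) → 0, and dist(x_k; 𝒳*) / dist(0; c + ∂‖·‖(x_k)) → ∞ as k → ∞. In particular, there are no constants κ, ε, η > 0 such that dist(x; 𝒳*) ≤ κ · dist(0; c + ∂‖·‖(x)) whenever F(x) ≤ η and dist(0; c + ∂‖·‖(x)) ≤ ε (the Luo–Tseng error bound fails). -/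
open scoped RealInnerProductSpace
open Metric Set Filter

noncomputable section

/-- The convex subdifferential of the Euclidean norm at `x`. -/
def normSubdiff {n : ℕ} (x : En n) : Set (En n) :=
  {v | ∀ y : En n, ‖x‖ + ⟪v, y - x⟫ ≤ ‖y‖}

/-- The set `c + ∂‖·‖(x)`. -/
def shiftedNormSubdiff {n : ℕ} (c x : En n) : Set (En n) :=
  (fun v => c + v) '' normSubdiff x

/-- The ray `{-γ • c : γ ≥ 0}`. -/
def negRay {n : ℕ} (c : En n) : Set (En n) :=
  {z | ∃ γ : ℝ, 0 ≤ γ ∧ z = -(γ • c)}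

/-- Away from the origin, the only subgradient of the norm is the normalized vector. -/
theorem normSubdiff_of_ne_zero {n : ℕ} {x : En n} (hx : x ≠ 0) :
    normSubdiff x = {‖x‖⁻¹ • x} := by
  have hr : 0 < ‖x‖ := norm_pos_iff.2 hx
  ext v
  simp only [normSubdiff, mem_ofPred_eq, mem_singleton_iff]
  constructor
  · intro h
    have h0 := h 0
    have h2 := h ((2 : ℝ) • x)
    have hv := h v
    simp only [inner_sub_right, inner_zero_right, inner_smul_right, norm_zero, norm_smul,
      real_inner_self_eq_norm_sq, Real.norm_ofNat] at h0 h2 hv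
    have hvx : ⟪v, x⟫ = ‖x‖ := by linarith
    have hv1 : ‖v‖ ^ 2 ≤ 1 := by
      have : ‖v‖ ≤ 1 := by
        by_contra! hlt
        nlinarith
      nlinarith [norm_nonneg v]
    have key : ‖v - ‖x‖⁻¹ • x‖ ^ 2 = ‖v‖ ^ 2 - 1 := by
      rw [norm_sub_sq_real, inner_smul_right, hvx, norm_smul, norm_inv, norm_norm]
      field_simp
      ring
    have : ‖v - ‖x‖⁻¹ • x‖ = 0 := by
      nlinarith [norm_nonneg (v - ‖x‖⁻¹ • x)]
    exact sub_eq_zero.1 (norm_eq_zero.1 this)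
  · rintro rfl y
    rw [inner_smul_left, inner_sub_right, real_inner_self_eq_norm_sq]
    have := real_inner_le_norm x y
    have h : ‖x‖⁻¹ * (⟪x, y⟫ - ‖x‖ ^ 2) ≤ ‖y‖ - ‖x‖ := by
      rw [inv_mul_le_iff₀ hr]
      nlinarith
    simpa using by linarith

theorem infDist_zero_shiftedNormSubdiff {n : ℕ} (c : En n) {x : En n} (hx : x ≠ 0) :
    infDist (0 : En n) (shiftedNormSubdiff c x) = ‖c + ‖x‖⁻¹ • x‖ := by
  rw [shiftedNormSubdiff, normSubdiff_of_ne_zero hx, image_singleton, infDist_singleton,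
    dist_zero_left]

/-- The squared residual is twice the objective gap divided by the norm. -/
theorem sq_norm_add_normalize {n : ℕ} {c x : En n} (hc : ‖c‖ = 1) (hx : x ≠ 0) :
    ‖c + ‖x‖⁻¹ • x‖ ^ 2 = 2 * (⟪c, x⟫ + ‖x‖) / ‖x‖ := by
  have hr : 0 < ‖x‖ := norm_pos_iff.2 hx
  rw [norm_add_sq_real, inner_smul_right, norm_smul, norm_inv, norm_norm, hc]
  field_simp
  ring

theorem exists_unit_orthogonal {n : ℕ} (hn : 2 ≤ n) (c : En n) :
    ∃ u : En n, ‖u‖ = 1 ∧ ⟪c, u⟫ = 0 := by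
  have hne : (ℝ ∙ c)ᗮ ≠ ⊥ := by
    intro h
    have htop := Submodule.orthogonal_eq_bot_iff.1 h
    have h1 := finrank_span_le_card (R := ℝ) ({c} : Set (En n))
    rw [htop, finrank_top, finrank_euclideanSpace_fin] at h1
    simp at h1
    omega
  obtain ⟨w, hw, hw0⟩ := Submodule.exists_mem_ne_zero_of_ne_bot hne
  refine ⟨‖w‖⁻¹ • w, ?_, ?_⟩
  · rw [norm_smul, norm_inv, norm_norm, inv_mul_cancel₀ (norm_ne_zero_iff.2 hw0)]
  · rw [inner_smul_right, Submodule.mem_orthogonal_singleton_iff_inner_right.1 hw, mul_zero]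

theorem one_le_dist_negRay {n : ℕ} {c u z : En n} (hu : ‖u‖ = 1) (hcu : ⟪c, u⟫ = 0) (m : ℝ)
    (hz : z ∈ negRay c) : 1 ≤ dist (u - m • c) z := by
  obtain ⟨γ, -, rfl⟩ := hz
  have h := real_inner_le_norm u (u - m • c - -(γ • c))
  have huc : ⟪u, c⟫ = 0 := by rw [real_inner_comm, hcu]
  simp only [inner_sub_right, inner_neg_right, inner_smul_right, real_inner_self_eq_norm_sq,
    hu, huc] at h
  rw [dist_eq_norm]
  linarith

theorem one_le_infDist_negRay {n : ℕ} {c u : En n} (hu : ‖u‖ = 1) (hcu : ⟪c, u⟫ = 0) (m : ℝ) :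
    1 ≤ infDist (u - m • c) (negRay c) := by
  have hne : (negRay c).Nonempty := ⟨0, 0, le_rfl, by simp⟩
  exact (le_infDist hne).2 fun _ hz => one_le_dist_negRay hu hcu m hz

theorem exists_seq_residual_ratio_tendsto_atTop {n : ℕ} (hn : 2 ≤ n) (c : En n) (hc : ‖c‖ = 1) :
    ∃ x : ℕ → En n,
      (∀ k, x k ∉ negRay c) ∧
      Tendsto (fun k => ⟪c, x k⟫ + ‖x k‖) atTop (nhds 0) ∧
      Tendsto (fun k => infDist (0 : En n) (shiftedNormSubdiff c (x k))) atTop (nhds 0) ∧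
      Tendsto (fun k => infDist (x k) (negRay c) /
          infDist (0 : En n) (shiftedNormSubdiff c (x k))) atTop atTop := by
  obtain ⟨u, hu, hcu⟩ := exists_unit_orthogonal hn c
  have huc : ⟪u, c⟫ = 0 := by rw [real_inner_comm, hcu]
  let x : ℕ → En n := fun k => u - ((k : ℝ) + 1) • c
  have hinner (k : ℕ) : ⟪c, x k⟫ = -((k : ℝ) + 1) := by
    simp [x, inner_sub_right, inner_smul_right, hcu, hc]
  have hnorm (k : ℕ) : ‖x k‖ ^ 2 = 1 + ((k : ℝ) + 1) ^ 2 := by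
    simp only [x]
    rw [norm_sub_sq_real, inner_smul_right, huc, norm_smul, hu, hc, Real.norm_eq_abs, mul_one,
      sq_abs]
    ring
  have hk (k : ℕ) : (1 : ℝ) ≤ (k : ℝ) + 1 := by linarith [k.cast_nonneg (α := ℝ)]
  have hlt (k : ℕ) : (k : ℝ) + 1 < ‖x k‖ :=
    lt_of_pow_lt_pow_left₀ 2 (norm_nonneg _) (by rw [hnorm]; linarith)
  have hx0 (k : ℕ) : x k ≠ 0 := norm_pos_iff.1 (by linarith [hk k, hlt k])
  have hFpos (k : ℕ) : 0 < ⟪c, x k⟫ + ‖x k‖ := by rw [hinner]; linarith [hlt k]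
  have hF : Tendsto (fun k => ⟪c, x k⟫ + ‖x k‖) atTop (nhds 0) := by
    refine squeeze_zero (fun k => (hFpos k).le) (fun k => ?_)
      (tendsto_one_div_add_atTop_nhds_zero_nat (𝕜 := ℝ))
    rw [hinner, le_div_iff₀ (by linarith [hk k])]
    nlinarith [hk k, hlt k, hnorm k]
  have hres (k : ℕ) : infDist (0 : En n) (shiftedNormSubdiff c (x k)) =
      √(2 * (⟪c, x k⟫ + ‖x k‖) / ‖x k‖) := by
    rw [infDist_zero_shiftedNormSubdiff c (hx0 k), ← sq_norm_add_normalize hc (hx0 k),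
      Real.sqrt_sq (norm_nonneg _)]
  have hpos (k : ℕ) : 0 < infDist (0 : En n) (shiftedNormSubdiff c (x k)) := by
    rw [hres]
    exact Real.sqrt_pos.2 (div_pos (by linarith [hFpos k]) (norm_pos_iff.2 (hx0 k)))
  have hlim : Tendsto (fun k => infDist (0 : En n) (shiftedNormSubdiff c (x k))) atTop
      (nhds 0) := by
    have hsqrt : Tendsto (fun k => √(2 * (⟪c, x k⟫ + ‖x k‖))) atTop (nhds 0) := by
      simpa using (hF.const_mul 2).sqrt
    refine squeeze_zero (fun k => (hpos k).le) (fun k => ?_) hsqrt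
    rw [hres]
    exact Real.sqrt_le_sqrt (div_le_self (by linarith [hFpos k]) (by linarith [hk k, hlt k]))
  refine ⟨x, fun k hmem => ?_, hF, hlim, ?_⟩
  · have := one_le_dist_negRay hu hcu ((k : ℝ) + 1) hmem
    simp only [x, dist_self] at this
    linarith
  · have hinv := (tendsto_nhdsWithin_iff.2 ⟨hlim, Eventually.of_forall hpos⟩).inv_tendsto_nhdsGT_zero
    refine tendsto_atTop_mono (fun k => ?_) hinv
    rw [Pi.inv_apply, inv_eq_one_div]
    exact div_le_div_of_nonneg_right (one_le_infDist_negRay hu hcu _) (hpos k).le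

/-- For `F x = ⟨c, x⟩ + ‖x‖` with `‖c‖ = 1` and `n ≥ 2`, there is a sequence
`x_k ∉ 𝒳* = {-γ c : γ ≥ 0}` with `F(x_k) → 0`, `dist(0, c + ∂‖·‖(x_k)) → 0`, and
`dist(x_k, 𝒳*) / dist(0, c + ∂‖·‖(x_k)) → ∞`; in particular the Luo–Tseng error bound fails. -/
theorem luo_tseng_error_bound_fails {n : ℕ} (hn : 2 ≤ n) (c : En n) (hc : ‖c‖ = 1) :
    (∃ x : ℕ → En n,
      (∀ k, x k ∉ negRay c) ∧
      Tendsto (fun k => ⟪c, x k⟫ + ‖x k‖) atTop (nhds 0) ∧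
      Tendsto (fun k => Metric.infDist (0 : En n) (shiftedNormSubdiff c (x k)))
        atTop (nhds 0) ∧
      Tendsto (fun k => Metric.infDist (x k) (negRay c) /
          Metric.infDist (0 : En n) (shiftedNormSubdiff c (x k))) atTop atTop) ∧
    ¬ (∃ κ > (0 : ℝ), ∃ ε > (0 : ℝ), ∃ η > (0 : ℝ), ∀ x : En n,
        ⟪c, x⟫ + ‖x‖ ≤ η →
        Metric.infDist (0 : En n) (shiftedNormSubdiff c x) ≤ ε →
        Metric.infDist x (negRay c) ≤
          κ * Metric.infDist (0 : En n) (shiftedNormSubdiff c x)) := by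
  obtain ⟨x, hmem, hF, hres, hratio⟩ := exists_seq_residual_ratio_tendsto_atTop hn c hc
  refine ⟨⟨x, hmem, hF, hres, hratio⟩, ?_⟩
  rintro ⟨κ, hκ, ε, hε, η, hη, hbound⟩
  obtain ⟨k, hFk, hresk, hratiok⟩ := ((hF.eventually_le_const hη).and
    ((hres.eventually_le_const hε).and (hratio.eventually_gt_atTop κ))).exists
  exact hratiok.not_ge (div_le_of_le_mul₀ infDist_nonneg hκ.le (hbound (x k) hFk hresk))
end
end

section
/- Let x̄ ∈ 𝒳*. Assume: (a) x ↦ ∇f(x) + ∂g(x) is metrically subregular at (x̄, 0) (i.e., metrically q-subregular with q = 1); (b) ∇²f is Lipschitz continuous on a neighborhood of x̄. Fix constants c, ᾱ, C₁ > 0, M ≥ 0, ν ∈ [0,1), and ϱ ≥ 1. Then there exist ε > 0, C₀ > 0, and C̃₀ > 0 such that: for every x with ‖x − x̄‖ < ε and 𝒢(x) ≠ 0, every symmetric positive semidefinite matrix B with ‖B‖ ≤ M and ‖B − ∇²f(x)‖ ≤ C₁ · dist(x; 𝒳*), and every x̂ ∈ ℝⁿ whose residual e = x̂ − Prox_g(x̂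 − ∇f(x) − H(x̂ − x)) with α = min{ᾱ, c‖𝒢(x)‖} and H = B + αI satisfies ‖e‖ ≤ ν · min{‖𝒢(x)‖, ‖𝒢(x)‖^{1+ϱ}}, one has both ‖𝒢(x̂)‖ ≤ C₀ · ‖𝒢(x)‖² and dist(x̂; 𝒳*) ≤ C̃₀ · dist(x; 𝒳*)². -/
open scoped RealInnerProductSpace
open Metric Set Filter

noncomputable section

lemma ESubdiff.ne_top {n : ℕ} {g : En n → EReal} (hg : ProperFun g) {x v : En n}
    (hv : v ∈ ESubdiff g x) : g x ≠ ⊤ := by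
  intro hx
  obtain ⟨y, hy⟩ := hg.2
  have h := hv y
  rw [hx, EReal.top_add_of_ne_bot (EReal.coe_ne_bot _), top_le_iff] at h
  exact hy h

/-- The convex subdifferential of a proper function is monotone. -/
lemma ESubdiff.inner_nonneg {n : ℕ} {g : En n → EReal} (hg : ProperFun g) {x y v w : En n}
    (hv : v ∈ ESubdiff g x) (hw : w ∈ ESubdiff g y) : 0 ≤ ⟪v - w, x - y⟫ := by
  have h₁ := hv y
  have h₂ := hw x
  lift g x to ℝ using ⟨ESubdiff.ne_top hg hv, hg.1 x⟩ with a
  lift g y to ℝ using ⟨ESubdiff.ne_top hg hw, hg.1 y⟩ with b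
  norm_cast at h₁ h₂
  rw [← neg_sub x y, inner_neg_right] at h₁
  rw [inner_sub_left]
  linarith

/-- Fermat's rule for the sum of a differentiable function and a convex one. -/
lemma neg_gradient_mem_ESubdiff {n : ℕ} {g : En n → EReal} (hg : ProperFun g)
    (hconv : EConvexOn g) {h : En n → ℝ} {x h' : En n} (hh : HasGradientAt h h' x)
    (hmin : ∀ y, g x + (h x : EReal) ≤ g y + (h y : EReal)) : -h' ∈ ESubdiff g x := by
  have hx : g x ≠ ⊤ := by
    intro hx
    obtain ⟨y, hy⟩ := hg.2
    have h₁ := hmin y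
    rw [hx, EReal.top_add_of_ne_bot (EReal.coe_ne_bot _), top_le_iff] at h₁
    lift g y to ℝ using ⟨hy, hg.1 y⟩ with b
    exact EReal.coe_ne_top (b + h y) (by exact_mod_cast h₁)
  intro y
  by_cases hy : g y = ⊤
  · rw [hy]; exact le_top
  obtain ⟨a, ha⟩ : ∃ a : ℝ, (a : EReal) = g x := ⟨_, EReal.coe_toReal hx (hg.1 x)⟩
  obtain ⟨b, hb⟩ : ∃ b : ℝ, (b : EReal) = g y := ⟨_, EReal.coe_toReal hy (hg.1 y)⟩
  have key : ∀ t : ℝ, 0 < t → t < 1 → a - b ≤ t⁻¹ * (h (x + t • (y - x)) - h x) := by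
    intro t ht ht1
    have h₁ := hmin ((1 - t) • x + t • y)
    have h₂ := hconv x y (1 - t) t (by linarith) ht.le (by ring)
    have h₃ := h₁.trans (add_le_add_left h₂ _)
    rw [← ha, ← hb] at h₃
    norm_cast at h₃
    have hz : (1 - t) • x + t • y = x + t • (y - x) := by module
    rw [hz] at h₃
    rw [inv_mul_eq_div, le_div_iff₀ ht]
    linarith
  have hline : HasDerivAt (fun t : ℝ => h (x + t • (y - x))) ⟪h', y - x⟫ 0 := by
    have hf : HasFDerivAt h (InnerProductSpace.toDual ℝ (En n) h') (x + (0 : ℝ) • (y - x)) := by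
      simpa using hh.hasFDerivAt
    have hl : HasDerivAt (fun t : ℝ => x + t • (y - x)) (y - x) 0 := by
      simpa using ((hasDerivAt_id (0 : ℝ)).smul_const (y - x)).const_add x
    have h₁ := hf.comp_hasDerivAt (0 : ℝ) hl
    rw [InnerProductSpace.toDual_apply_apply] at h₁
    exact h₁
  have hlim := hline.tendsto_slope_zero_right
  simp only [zero_add, zero_smul, add_zero, smul_eq_mul] at hlim
  have hle : a - b ≤ ⟪h', y - x⟫ := by
    refine ge_of_tendsto hlim ?_
    filter_upwards [Ioo_mem_nhdsGT (zero_lt_one' ℝ)] with t ht using key t ht.1 ht.2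
  rw [← ha, ← hb, inner_neg_left]
  norm_cast
  linarith

lemma IsProxPt.sub_mem_ESubdiff {n : ℕ} {g : En n → EReal} (hg : ProperFun g)
    (hconv : EConvexOn g) {u p : En n} (hp : IsProxPt g u p) : u - p ∈ ESubdiff g p := by
  have hgrad : HasGradientAt (fun y : En n => ‖y - u‖ ^ 2 / 2) (p - u) p := by
    rw [hasGradientAt_iff_hasFDerivAt]
    have h := (((hasFDerivAt_id p).sub_const u).norm_sq).const_mul (1 / 2 : ℝ)
    refine (h.congr_fderiv ?_).congr_of_eventuallyEq (Eventually.of_forall fun y => ?_)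
    · ext v
      simp
    · simp only [id]
      ring
  simpa using neg_gradient_mem_ESubdiff hg hconv hgrad hp

lemma neg_gradient_mem_ESubdiff_of_mem_ArgminSet {n : ℕ} {f : En n → ℝ} {g : En n → EReal}
    (hg : ProperFun g) (hconv : EConvexOn g) {x f' : En n} (hf : HasGradientAt f f' x)
    (hx : x ∈ ArgminSet f g) : -f' ∈ ESubdiff g x :=
  neg_gradient_mem_ESubdiff hg hconv hf fun y => by
    simpa only [add_comm (g _)] using hx y

/-- The prox-gradient residual is bounded by the distance to any minimizer. -/
lemma norm_Gmap_le {n : ℕ} {f : En n → ℝ} {f' : En n → En n} {g : En n → EReal}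
    {prox : En n → En n} {L : ℝ} (hgrad : ∀ x, HasGradientAt f (f' x) x)
    (hlip : ∀ x y : En n, ‖f' x - f' y‖ ≤ L * ‖x - y‖) (hg : ProperFun g)
    (hconv : EConvexOn g) (hprox : IsProxMap g prox) {x z : En n} (hz : z ∈ ArgminSet f g) :
    ‖Gmap f' prox x‖ ≤ (2 + L) * ‖x - z‖ := by
  set y := prox (x - f' x) with hy
  have h₁ : x - f' x - y ∈ ESubdiff g y := (hprox _).1.sub_mem_ESubdiff hg hconv
  have h₂ := neg_gradient_mem_ESubdiff_of_mem_ArgminSet hg hconv (hgrad z) hz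
  have h₃ := ESubdiff.inner_nonneg hg h₁ h₂
  have h₄ : x - f' x - y - -f' z = (x - z) - (f' x - f' z) - (y - z) := by abel
  rw [h₄, inner_sub_left, real_inner_self_eq_norm_sq] at h₃
  have h₅ : ‖(x - z) - (f' x - f' z)‖ ≤ (1 + L) * ‖x - z‖ :=
    (norm_sub_le _ _).trans (by linarith [hlip x z])
  have h₆ := real_inner_le_norm ((x - z) - (f' x - f' z)) (y - z)
  have h₇ : ‖y - z‖ ≤ ‖(x - z) - (f' x - f' z)‖ := by
    by_contra! hlt
    nlinarith [norm_nonneg ((x - z) - (f' x - f' z))]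
  have h₈ : Gmap f' prox x = (x - z) - (y - z) := by rw [Gmap, ← hy]; abel
  rw [h₈]
  linarith [norm_sub_le (x - z) (y - z)]

lemma norm_Gmap_le_infDist {n : ℕ} {f : En n → ℝ} {f' : En n → En n} {g : En n → EReal}
    {prox : En n → En n} {L : ℝ} (hL : 0 < L) (hgrad : ∀ x, HasGradientAt f (f' x) x)
    (hlip : ∀ x y : En n, ‖f' x - f' y‖ ≤ L * ‖x - y‖) (hg : ProperFun g)
    (hconv : EConvexOn g) (hprox : IsProxMap g prox) (hne : (ArgminSet f g).Nonempty)
    (x : En n) : ‖Gmap f' prox x‖ ≤ (2 + L) * infDist x (ArgminSet f g) := by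
  rw [← div_le_iff₀' (by linarith)]
  refine (le_infDist hne).2 fun z hz => ?_
  rw [div_le_iff₀' (by linarith), dist_eq_norm]
  exact norm_Gmap_le hgrad hlip hg hconv hprox hz

/-- First-order Taylor estimate for a map whose derivative is Lipschitz on a convex set. -/
lemma norm_taylor_le {E : Type*} [NormedAddCommGroup E] [NormedSpace ℝ E] {f' : E → E}
    {f'' : E → E →L[ℝ] E} (hhess : ∀ x, HasFDerivAt f' (f'' x) x) {s : Set E}
    (hs : Convex ℝ s) {L : ℝ} (hL : 0 ≤ L)
    (hlip : ∀ x ∈ s, ∀ y ∈ s, ‖f'' x - f'' y‖ ≤ L * ‖x - y‖) {x y : E} (hx : x ∈ s)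
    (hy : y ∈ s) : ‖f' y - f' x - f'' x (y - x)‖ ≤ L * ‖y - x‖ ^ 2 := by
  have h := (convex_segment x y).norm_image_sub_le_of_norm_hasFDerivWithin_le'
    (C := L * ‖y - x‖) (φ := f'' x) (fun z _ => (hhess z).hasFDerivWithinAt) (fun z hz => ?_)
    (left_mem_segment ℝ x y) (right_mem_segment ℝ x y)
  · exact h.trans_eq (by ring)
  · refine (hlip z (hs.segment_subset hx hy hz) x hx).trans ?_
    gcongr
    exact norm_sub_le_of_mem_segment hz

/-- A priori bound for a regularized inexact proximal Newton step `w + e` from `x`, relative to a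
point `z` at which `-b ∈ ∂g z`. -/
lemma proxNewton_step_bound {n : ℕ} {g : En n → EReal} (hg : ProperFun g) {B : En n →L[ℝ] En n}
    (hB : ∀ u : En n, 0 ≤ ⟪B u, u⟫) {α : ℝ} (hα : 0 ≤ α) {x z xhat e a b : En n}
    (hp : e - a - (B (xhat - x) + α • (xhat - x)) ∈ ESubdiff g (xhat - e))
    (hz : -b ∈ ESubdiff g z) :
    α * ‖xhat - e - z‖ ≤
      (1 + ‖B‖ + α) * ‖e‖ + ‖b - a - B (z - x)‖ + α * ‖z - x‖ := by
  set w := xhat - e - z with hw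
  have h₁ := ESubdiff.inner_nonneg hg hp hz
  have h₂ : e - a - (B (xhat - x) + α • (xhat - x)) - -b =
      (e - B e - α • e + (b - a - B (z - x)) - α • (z - x)) - (B w + α • w) := by
    have h₃ : xhat - x = w + e + (z - x) := by rw [hw]; abel
    rw [h₃]
    simp only [map_add, smul_add]
    abel
  rw [h₂, ← hw, inner_sub_left, inner_add_left (B w), real_inner_smul_left,
    real_inner_self_eq_norm_sq] at h₁
  set q := e - B e - α • e + (b - a - B (z - x)) - α • (z - x) with hq
  have h₄ : ‖q‖ ≤ (1 + ‖B‖ + α) * ‖e‖ + ‖b - a - B (z - x)‖ + α * ‖z - x‖ := by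
    have n₁ := norm_sub_le (e - B e - α • e + (b - a - B (z - x))) (α • (z - x))
    have n₂ := norm_add_le (e - B e - α • e) (b - a - B (z - x))
    have n₃ := norm_sub_le (e - B e) (α • e)
    have n₄ := norm_sub_le e (B e)
    have n₅ := B.le_opNorm e
    rw [norm_smul, Real.norm_of_nonneg hα] at n₁ n₃
    linarith
  refine le_trans ?_ h₄
  have h₅ := real_inner_le_norm q w
  have h₆ := hB w
  rcases (norm_nonneg w).eq_or_lt with h0 | h0
  · rw [← h0, mul_zero]; exact norm_nonneg _
  · refine le_of_mul_le_mul_right ?_ h0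
    linarith

/-- Metric subregularity at a minimizer gives a local error bound in terms of the prox-gradient
residual. -/
lemma infDist_le_norm_Gmap {n : ℕ} {f : En n → ℝ} {f' : En n → En n} {g : En n → EReal}
    {prox : En n → En n} {L : ℝ} (hlip : ∀ x y : En n, ‖f' x - f' y‖ ≤ L * ‖x - y‖)
    (hg : ProperFun g) (hconv : EConvexOn g) (hprox : IsProxMap g prox) {xbar : En n}
    {κ ε : ℝ} (hκ : 0 ≤ κ)
    (hsubreg : ∀ x : En n, ‖x - xbar‖ < ε → ∀ v ∈ ESubdiff g x,
      infDist x (ArgminSet f g) ≤ κ * ‖f' x + v‖)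
    {x : En n} (hx : ‖x - xbar‖ + ‖Gmap f' prox x‖ < ε) :
    infDist x (ArgminSet f g) ≤ (1 + κ * (1 + L)) * ‖Gmap f' prox x‖ := by
  set y := prox (x - f' x) with hy
  have hG : Gmap f' prox x = x - y := rfl
  rw [hG] at hx ⊢
  have h₁ : x - f' x - y ∈ ESubdiff g y := (hprox _).1.sub_mem_ESubdiff hg hconv
  have h₂ : ‖y - xbar‖ < ε := by
    have h : y - xbar = (x - xbar) - (x - y) := by abel
    rw [h]
    exact (norm_sub_le _ _).trans_lt hx
  have h₃ := hsubreg y h₂ _ h₁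
  have h₄ : ‖f' y + (x - f' x - y)‖ ≤ (1 + L) * ‖x - y‖ := by
    have h : f' y + (x - f' x - y) = (x - y) - (f' x - f' y) := by abel
    rw [h]
    exact (norm_sub_le _ _).trans (by linarith [hlip x y])
  have h₅ := infDist_le_infDist_add_dist (s := ArgminSet f g) (x := x) (y := y)
  rw [dist_eq_norm] at h₅
  nlinarith [mul_le_mul_of_nonneg_left h₄ hκ]

set_option maxHeartbeats 1600000 in
/-- Under metric subregularity (q = 1) and local Lipschitz continuity of
the Hessian, with `ρ = 1` in the algorithm, an inexact proximal Newton step satisfies both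
`‖𝒢(xhat)‖ ≤ C₀ ‖𝒢(x)‖²` and `dist(xhat, 𝒳*) ≤ C̃₀ dist(x, 𝒳*)²` near `x̄`. -/
theorem quadratic_convergence_estimate {n : ℕ}
    (f : En n → ℝ) (f' : En n → En n) (f'' : En n → En n →L[ℝ] En n)
    (g : En n → EReal) (prox : En n → En n)
    (L₁ : ℝ) (hL₁ : 0 < L₁)
    (hfconv : ConvexOn ℝ Set.univ f)
    (hgrad : ∀ x, HasGradientAt f (f' x) x)
    (hhess : ∀ x, HasFDerivAt f' (f'' x) x)
    (hhesscont : Continuous f'')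
    (hlip : ∀ x y : En n, ‖f' x - f' y‖ ≤ L₁ * ‖x - y‖)
    (hgproper : ProperFun g) (hglsc : LowerSemicontinuous g) (hgconv : EConvexOn g)
    (hprox : IsProxMap g prox)
    (hXne : (ArgminSet f g).Nonempty)
    (xbar : En n) (hxbar : xbar ∈ ArgminSet f g)
    (hsubreg : ∃ κ > (0 : ℝ), ∃ ε > (0 : ℝ), ∀ x : En n, ‖x - xbar‖ < ε →
      ∀ v ∈ ESubdiff g x, Metric.infDist x (ArgminSet f g) ≤ κ * ‖f' x + v‖)
    (hhesslip : ∃ δ > (0 : ℝ), ∃ L₂ : ℝ, ∀ x ∈ Metric.ball xbar δ, ∀ y ∈ Metric.ball xbar δ,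
      ‖f'' x - f'' y‖ ≤ L₂ * ‖x - y‖)
    (c ᾱ C₁ : ℝ) (hc : 0 < c) (hᾱ : 0 < ᾱ) (hC₁ : 0 < C₁)
    (M : ℝ) (hM : 0 ≤ M)
    (ν : ℝ) (hν0 : 0 ≤ ν) (hν1 : ν < 1)
    (ϱ : ℝ) (hϱ : 1 ≤ ϱ) :
    ∃ ε > (0 : ℝ), ∃ C₀ > (0 : ℝ), ∃ C₀' > (0 : ℝ),
      ∀ x : En n, ‖x - xbar‖ < ε → Gmap f' prox x ≠ 0 →
      ∀ B : En n →L[ℝ] En n,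
        (∀ u v : En n, ⟪B u, v⟫ = ⟪u, B v⟫) → (∀ u : En n, 0 ≤ ⟪B u, u⟫) →
        ‖B‖ ≤ M → ‖B - f'' x‖ ≤ C₁ * Metric.infDist x (ArgminSet f g) →
      ∀ xhat : En n,
        ‖xhat - prox (xhat - f' x - (B (xhat - x) +
            (min ᾱ (c * ‖Gmap f' prox x‖)) • (xhat - x)))‖ ≤
          ν * min ‖Gmap f' prox x‖ (‖Gmap f' prox x‖ ^ (1 + ϱ)) →
        ‖Gmap f' prox xhat‖ ≤ C₀ * ‖Gmap f' prox x‖ ^ 2 ∧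
        Metric.infDist xhat (ArgminSet f g) ≤
          C₀' * Metric.infDist x (ArgminSet f g) ^ 2 := by
  obtain ⟨κ, hκ, ε₁, hε₁, hsub⟩ := hsubreg
  obtain ⟨δ, hδ, L₂, hL₂⟩ := hhesslip
  set S := ArgminSet f g with hS
  set L := max L₂ 0 with hLdef
  have hL : 0 ≤ L := le_max_right _ _
  have htaylor : ∀ x ∈ ball xbar δ, ∀ y ∈ ball xbar δ,
      ‖f' y - f' x - f'' x (y - x)‖ ≤ L * ‖y - x‖ ^ 2 := fun x hx y hy =>
    norm_taylor_le hhess (convex_ball _ _) hL (fun u hu v hv => (hL₂ u hu v hv).trans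
      (mul_le_mul_of_nonneg_right (le_max_left _ _) (norm_nonneg _))) hx hy
  set K := 2 + L₁ with hK
  set A := 1 + κ * (1 + L₁) with hA
  set D := (1 + M + ᾱ) + 4 * L * A ^ 2 + 2 * C₁ * A ^ 2 + 2 * c * A with hD
  set E := D / c + 1 + 2 * A with hE
  set V := 1 + L₁ + L * E ^ 2 + C₁ * A * E + c * E with hV
  set W := κ * V + 1 with hW
  have hK0 : 0 < K := by positivity
  have hA0 : 0 < A := by positivity
  have hD0 : 0 < D := by positivity
  have hE0 : 0 < E := by positivity
  have hV0 : 0 < V := by positivity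
  have hW0 : 0 < W := by positivity
  set Q := 3 + (E + 2) * K with hQ
  have hQ0 : 0 < Q := by positivity
  set m := min (min 1 (ᾱ / c)) (min ε₁ δ) with hm
  have hm0 : 0 < m := by
    have : 0 < ᾱ / c := by positivity
    simp only [hm, lt_min_iff]
    exact ⟨⟨one_pos, this⟩, hε₁, hδ⟩
  refine ⟨m / Q, by positivity, K * W, by positivity, W * K ^ 2, by positivity, ?_⟩
  intro x hx hGx B _ hBpos hBM hBx xhat hres
  rw [lt_div_iff₀' hQ0] at hx
  set r := ‖Gmap f' prox x‖ with hr
  set d := infDist x S with hd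
  have hr0 : 0 < r := norm_pos_iff.2 hGx
  have hrd : r ≤ K * d := norm_Gmap_le_infDist hL₁ hgrad hlip hgproper hgconv hprox hXne x
  have hd0 : 0 < d := pos_of_mul_pos_right (hr0.trans_le hrd) hK0.le
  have hrx : r ≤ K * ‖x - xbar‖ :=
    norm_Gmap_le hgrad hlip hgproper hgconv hprox hxbar
  have hN0 := norm_nonneg (x - xbar)
  have hEr : E * r ≤ E * K * ‖x - xbar‖ := by
    rw [mul_assoc]; exact mul_le_mul_of_nonneg_left hrx hE0.le
  have hEK : 0 ≤ E * K * ‖x - xbar‖ := by positivity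
  have hKN : 0 ≤ K * ‖x - xbar‖ := by positivity
  have hsum : 3 * ‖x - xbar‖ + (E * r + 2 * r) < m := by
    refine lt_of_le_of_lt ?_ hx
    rw [hQ]
    linarith
  have hEr0 : 0 ≤ E * r := by positivity
  have hm1 : m ≤ 1 := (min_le_left _ _).trans (min_le_left _ _)
  have hmα : m ≤ ᾱ / c := (min_le_left _ _).trans (min_le_right _ _)
  have hmε : m ≤ ε₁ := (min_le_right _ _).trans (min_le_left _ _)
  have hmδ : m ≤ δ := (min_le_right _ _).trans (min_le_right _ _)
  have hr1 : r ≤ 1 := by linarith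
  have hcr : c * r ≤ ᾱ := by
    rw [← le_div_iff₀' hc]; linarith
  rw [min_eq_right hcr] at hres
  set p := prox (xhat - f' x - (B (xhat - x) + (c * r) • (xhat - x))) with hp
  set e := xhat - p with he
  have her : ‖e‖ ≤ r ^ 2 := by
    refine hres.trans ((mul_le_of_le_one_left ?_ hν1.le).trans ?_)
    · positivity
    · refine (min_le_right _ _).trans ?_
      rw [← Real.rpow_two]
      exact Real.rpow_le_rpow_of_exponent_ge hr0 hr1 (by linarith)
  have hr2 : r ^ 2 ≤ r := pow_le_of_le_one hr0.le hr1 two_ne_zero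
  have hpe : xhat - e = p := sub_sub_cancel _ _
  have hdA : d ≤ A * r := infDist_le_norm_Gmap hlip hgproper hgconv hprox hκ.le hsub (by linarith)
  have hdx : d ≤ ‖x - xbar‖ := by
    rw [← dist_eq_norm]; exact infDist_le_dist_of_mem hxbar
  obtain ⟨z, hzS, hz⟩ := (infDist_lt_iff hXne).1 (show infDist x S < 2 * d by linarith)
  rw [dist_comm, dist_eq_norm] at hz
  have hmem : e - f' x - (B (xhat - x) + (c * r) • (xhat - x)) ∈ ESubdiff g p := by
    have h := (hprox (xhat - f' x - (B (xhat - x) + (c * r) • (xhat - x)))).1.sub_mem_ESubdiff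
      hgproper hgconv
    rw [← hp] at h
    convert h using 1
    rw [he]; abel
  have hzsub := neg_gradient_mem_ESubdiff_of_mem_ArgminSet hgproper hgconv (hgrad z) hzS
  have hstep := proxNewton_step_bound hgproper hBpos (by positivity) (hpe.symm ▸ hmem) hzsub
  rw [hpe] at hstep
  have hxball : x ∈ ball xbar δ := by rw [mem_ball_iff_norm]; linarith
  have hzball : z ∈ ball xbar δ := by
    rw [mem_ball_iff_norm]
    linarith [norm_sub_le_norm_sub_add_norm_sub z x xbar]
  have hlin : ∀ y ∈ ball xbar δ, ‖f' y - f' x - B (y - x)‖ ≤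
      L * ‖y - x‖ ^ 2 + C₁ * A * r * ‖y - x‖ := fun y hy => by
    have h₁ : f' y - f' x - B (y - x) =
        (f' y - f' x - f'' x (y - x)) - (B - f'' x) (y - x) := by
      rw [sub_apply]; abel
    have h₂ := (B - f'' x).le_of_opNorm_le (hBx.trans (mul_le_mul_of_nonneg_left hdA hC₁.le)) (y - x)
    rw [h₁]
    refine (norm_sub_le _ _).trans (add_le_add (htaylor x hxball y hy) (h₂.trans_eq (by ring)))
  have hzr : ‖z - x‖ ≤ 2 * A * r := by linarith
  have hw : ‖p - z‖ ≤ D / c * r := by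
    have h₁ := hlin z hzball
    have h₂ : L * ‖z - x‖ ^ 2 ≤ L * (2 * A * r) ^ 2 := by gcongr
    have h₃ : C₁ * A * r * ‖z - x‖ ≤ C₁ * A * r * (2 * A * r) := by gcongr
    have h₄ : c * r * ‖z - x‖ ≤ c * r * (2 * A * r) := by gcongr
    have h₅ : (1 + ‖B‖ + c * r) * ‖e‖ ≤ (1 + M + ᾱ) * r ^ 2 := by gcongr
    have h₆ : c * r * ‖p - z‖ ≤ c * r * (D / c * r) := by
      have : c * r * (D / c * r) = D * r ^ 2 := by field_simp
      rw [this, hD]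
      linarith
    exact le_of_mul_le_mul_left h₆ (by positivity)
  have hxr : ‖xhat - x‖ ≤ E * r := by
    have h₁ : xhat - x = (p - z) + e + (z - x) := by rw [he]; abel
    rw [h₁, hE]
    linarith [norm_add₃_le (a := p - z) (b := e) (c := z - x)]
  have hxhatball : xhat ∈ ball xbar δ := by
    rw [mem_ball_iff_norm]
    linarith [norm_sub_le_norm_sub_add_norm_sub xhat x xbar]
  have hpε : ‖p - xbar‖ < ε₁ := by
    have h₁ := norm_sub_le_norm_sub_add_norm_sub xhat x xbar
    have h₂ := norm_sub_le_norm_sub_add_norm_sub p xhat xbar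
    rw [norm_sub_rev p xhat] at h₂
    linarith
  have hv : ‖f' p + (e - f' x - (B (xhat - x) + (c * r) • (xhat - x)))‖ ≤ V * r ^ 2 := by
    have h₁ : f' p + (e - f' x - (B (xhat - x) + (c * r) • (xhat - x))) =
        (e - (f' xhat - f' p)) + (f' xhat - f' x - B (xhat - x)) - (c * r) • (xhat - x) := by
      abel
    have n₁ := norm_sub_le ((e - (f' xhat - f' p)) + (f' xhat - f' x - B (xhat - x)))
      ((c * r) • (xhat - x))
    have n₂ := norm_add_le (e - (f' xhat - f' p)) (f' xhat - f' x - B (xhat - x))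
    have n₃ := norm_sub_le e (f' xhat - f' p)
    have n₄ : ‖f' xhat - f' p‖ ≤ L₁ * ‖e‖ := hlip xhat p
    have n₅ := hlin xhat hxhatball
    rw [norm_smul, Real.norm_of_nonneg (by positivity)] at n₁
    have h₂ : L * ‖xhat - x‖ ^ 2 ≤ L * (E * r) ^ 2 := by gcongr
    have h₃ : C₁ * A * r * ‖xhat - x‖ ≤ C₁ * A * r * (E * r) := by gcongr
    have h₄ : c * r * ‖xhat - x‖ ≤ c * r * (E * r) := by gcongr
    have h₅ : L₁ * ‖e‖ ≤ L₁ * r ^ 2 := by gcongr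
    rw [h₁, hV]
    linarith
  have hdist : infDist xhat S ≤ W * r ^ 2 := by
    have h₁ := infDist_le_infDist_add_dist (s := S) (x := xhat) (y := p)
    rw [dist_eq_norm] at h₁
    have h₂ := (hsub p hpε _ hmem).trans (mul_le_mul_of_nonneg_left hv hκ.le)
    rw [hW]
    linarith
  refine ⟨?_, hdist.trans ?_⟩
  · refine (norm_Gmap_le_infDist hL₁ hgrad hlip hgproper hgconv hprox hXne xhat).trans ?_
    rw [mul_assoc]
    exact mul_le_mul_of_nonneg_left hdist hK0.le
  · rw [mul_assoc, ← mul_pow]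
    gcongr
end
end
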